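/- arXiv:1805.06685 — 4 statements merged into one kernel-verified Lean document; each statement's English description precedes it below -/
import Mathlib

section
/- Let n ≥ 2 and let 𝓜 be a primitive finite set of n×n binary NZ matrices. Then K_𝓜(n) > 1/n. -/
open scoped BigOperators

/-- Binary (Boolean) `n × n` matrices. -/
abbrev BMat (n : ℕ) := Matrix (Fin n) (Fin n) Bool

/-- Boolean matrix product: `(A ⊙ B)[i,j] = 1` iff `∑ₖ A[i,k]·B[k,j] > 0`. -/
def bProd {n : ℕ} (A B : BMat n) : BMat n :=
  Matrix.of fun i j => decide (∃ k, A i k = true ∧ B k j = true)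

/-- The identity binary matrix. -/
def bId (n : ℕ) : BMat n := Matrix.of fun i j => decide (i = j)

/-- The all-ones binary matrix. -/
def bOnes (n : ℕ) : BMat n := Matrix.of fun _ _ => true

/-- Boolean product of a list of binary matrices (empty product = identity). -/
def listProd {n : ℕ} (l : List (BMat n)) : BMat n := l.foldr bProd (bId n)

/-- A binary matrix is NZ if every row and every column contains a `1`. -/
def IsNZ {n : ℕ} (A : BMat n) : Prop :=
  (∀ i, ∃ j, A i j = true) ∧ (∀ j, ∃ i, A i j = true)

/-- `𝓜^{≤t}`: all boolean products of at most `t` matrices from `M`. -/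
def prodsLe {n : ℕ} (M : Set (BMat n)) (t : ℕ) : Set (BMat n) :=
  { P | ∃ l : List (BMat n), l.length ≤ t ∧ (∀ A ∈ l, A ∈ M) ∧ P = listProd l }

/-- `𝓜^{t}`: all boolean products of exactly `t` matrices from `M`. -/
def prodsEq {n : ℕ} (M : Set (BMat n)) (t : ℕ) : Set (BMat n) :=
  { P | ∃ l : List (BMat n), l.length = t ∧ (∀ A ∈ l, A ∈ M) ∧ P = listProd l }

/-- `(Ae)_i`: the number of `1`-entries in row `i` of `A`, as a real number. -/
def rowSum {n : ℕ} (A : BMat n) (i : Fin n) : ℝ :=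
  ∑ j, if A i j then (1 : ℝ) else 0

/-- The number of `1`-entries in row `i` of `A`, as a natural number. -/
def rCount {n : ℕ} (A : BMat n) (i : Fin n) : ℕ :=
  (Finset.univ.filter fun j => A i j = true).card

/-- A stochastic vector: nonnegative entries summing to `1`. -/
def IsStochastic {m : ℕ} (p : Fin m → ℝ) : Prop :=
  (∀ i, 0 ≤ p i) ∧ ∑ i, p i = 1

/-- `pᵀ(Ae)`. -/
def payoff {n : ℕ} (p : Fin n → ℝ) (A : BMat n) : ℝ := ∑ i, p i * rowSum A i

/-- `max_{A ∈ 𝓜^{≤t}} pᵀ(Ae)`. -/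
noncomputable def maxPayoff {n : ℕ} (M : Set (BMat n)) (t : ℕ) (p : Fin n → ℝ) : ℝ :=
  sSup { x | ∃ A ∈ prodsLe M t, x = payoff p A }

/-- The synchronizing probability function
`K_𝓜(t) = min_p max_{A ∈ 𝓜^{≤t}} pᵀ(Ae)/n`. -/
noncomputable def Kval {n : ℕ} (M : Set (BMat n)) (t : ℕ) : ℝ :=
  sInf { v | ∃ p : Fin n → ℝ, IsStochastic p ∧ v = maxPayoff M t p } / n

/-- The set `P_t` of optimal stochastic vectors for `K_𝓜(t)`. -/
noncomputable def Pset {n : ℕ} (M : Set (BMat n)) (t : ℕ) : Set (Fin n → ℝ) :=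
  { p | IsStochastic p ∧ maxPayoff M t p = n * Kval M t }

/-- A set of binary matrices is primitive if some (nonempty) boolean product of its
elements equals the all-ones matrix. -/
def IsPrimitive {n : ℕ} (M : Set (BMat n)) : Prop :=
  ∃ l : List (BMat n), l ≠ [] ∧ (∀ A ∈ l, A ∈ M) ∧ listProd l = bOnes n

/-- The exponent of a primitive set: the length of its shortest positive product. -/
noncomputable def expM {n : ℕ} (M : Set (BMat n)) : ℕ :=
  sInf { t | ∃ l : List (BMat n),
    l.length = t ∧ l ≠ [] ∧ (∀ A ∈ l, A ∈ M) ∧ listProd l = bOnes n }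

/-- `max_{A ∈ 𝓜^{≤t}} r_i(A)`. -/
noncomputable def rowMaxN {n : ℕ} (M : Set (BMat n)) (t : ℕ) (i : Fin n) : ℕ :=
  sSup { r | ∃ A ∈ prodsLe M t, r = rCount A i }

/-- `min_{1≤i≤n} max_{A ∈ 𝓜^{≤t}} r_i(A)`. -/
noncomputable def KbarN {n : ℕ} (M : Set (BMat n)) (t : ℕ) : ℕ :=
  sInf { r | ∃ i : Fin n, r = rowMaxN M t i }

/-- The approximated synchronizing probability function
`K̄_𝓜(t) = (1/n)·min_i max_{A ∈ 𝓜^{≤t}} r_i(A)`. -/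
noncomputable def Kbar {n : ℕ} (M : Set (BMat n)) (t : ℕ) : ℝ := (KbarN M t : ℝ) / n

/-- `P̄_t`: the set of row indices attaining the minimum in `K̄_𝓜(t)`. -/
noncomputable def Pbar {n : ℕ} (M : Set (BMat n)) (t : ℕ) : Set (Fin n) :=
  { i | rowMaxN M t i = KbarN M t }

lemma bProd_apply {n : ℕ} (A B : BMat n) (i j : Fin n) :
    bProd A B i j = true ↔ ∃ k, A i k = true ∧ B k j = true := by
  simp [bProd]

lemma bId_apply {n : ℕ} (i j : Fin n) : bId n i j = true ↔ i = j := by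
  simp [bId]

lemma listProd_cons_apply {n : ℕ} (A : BMat n) (l : List (BMat n)) (i j : Fin n) :
    listProd (A :: l) i j = true ↔ ∃ k, A i k = true ∧ listProd l k j = true :=
  bProd_apply A (listProd l) i j

lemma listProd_nil_apply {n : ℕ} (i j : Fin n) :
    listProd ([] : List (BMat n)) i j = true ↔ i = j :=
  bId_apply i j

lemma listProd_concat_apply {n : ℕ} (l : List (BMat n)) (A : BMat n) (i j : Fin n) :
    listProd (l ++ [A]) i j = true ↔ ∃ k, listProd l i k = true ∧ A k j = true := by
  induction l generalizing i with
  | nil => simp [listProd_cons_apply, listProd_nil_apply]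
  | cons B l ih =>
    simp only [List.cons_append, listProd_cons_apply, ih]
    constructor
    · rintro ⟨k, hk, m, hm, hj⟩
      exact ⟨m, ⟨k, hk, hm⟩, hj⟩
    · rintro ⟨m, ⟨k, hk, hm⟩, hj⟩
      exact ⟨k, hk, m, hm, hj⟩

/-- Boolean products of matrices without zero rows have no zero row. -/
lemma exists_listProd_apply {n : ℕ} {l : List (BMat n)}
    (hl : ∀ A ∈ l, ∀ i, ∃ j, A i j = true) (i : Fin n) : ∃ j, listProd l i j = true := by
  induction l generalizing i with
  | nil => exact ⟨i, (listProd_nil_apply i i).2 rfl⟩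
  | cons B l ih =>
    obtain ⟨k, hk⟩ := hl B (by simp) i
    obtain ⟨j, hj⟩ := ih (fun A hA => hl A (by simp [hA])) k
    exact ⟨j, (listProd_cons_apply B l i j).2 ⟨k, hk, hj⟩⟩

open Classical in
/-- The indices reachable from `i` by products of at most `t` matrices from `M`. -/
noncomputable def reachLe {n : ℕ} (M : Set (BMat n)) (i : Fin n) (t : ℕ) : Finset (Fin n) :=
  Finset.univ.filter fun j => ∃ A ∈ prodsLe M t, A i j = true

lemma mem_reachLe {n : ℕ} {M : Set (BMat n)} {i j : Fin n} {t : ℕ} :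
    j ∈ reachLe M i t ↔
      ∃ l : List (BMat n), l.length ≤ t ∧ (∀ A ∈ l, A ∈ M) ∧ listProd l i j = true := by
  classical
  rw [reachLe, Finset.mem_filter, and_iff_right (Finset.mem_univ j)]
  constructor
  · rintro ⟨_, ⟨l, h1, h2, rfl⟩, h⟩
    exact ⟨l, h1, h2, h⟩
  · rintro ⟨l, h1, h2, h⟩
    exact ⟨_, ⟨l, h1, h2, rfl⟩, h⟩

lemma self_mem_reachLe {n : ℕ} (M : Set (BMat n)) (i : Fin n) (t : ℕ) : i ∈ reachLe M i t :=
  mem_reachLe.2 ⟨[], by simp, by simp, (listProd_nil_apply i i).2 rfl⟩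

lemma reachLe_subset_succ {n : ℕ} (M : Set (BMat n)) (i : Fin n) (t : ℕ) :
    reachLe M i t ⊆ reachLe M i (t + 1) := by
  intro j hj
  obtain ⟨l, h1, h2, h⟩ := mem_reachLe.1 hj
  exact mem_reachLe.2 ⟨l, by omega, h2, h⟩

lemma mem_reachLe_succ {n : ℕ} {M : Set (BMat n)} {i j k : Fin n} {t : ℕ} {A : BMat n}
    (hj : j ∈ reachLe M i t) (hA : A ∈ M) (hjk : A j k = true) : k ∈ reachLe M i (t + 1) := by
  obtain ⟨l, h1, h2, h⟩ := mem_reachLe.1 hj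
  refine mem_reachLe.2 ⟨l ++ [A], by simpa using h1, ?_,
    (listProd_concat_apply l A i k).2 ⟨j, h, hjk⟩⟩
  simp only [List.mem_append, List.mem_singleton]
  rintro B (hB | rfl)
  exacts [h2 B hB, hA]

/-- The reachable sets stop growing before step `n`. -/
lemma exists_reachLe_succ_eq {n : ℕ} (M : Set (BMat n)) (i : Fin n) :
    ∃ t < n, reachLe M i (t + 1) = reachLe M i t := by
  by_contra! hne
  have hcard : ∀ t ≤ n, t + 1 ≤ (reachLe M i t).card := by
    intro t
    induction t with
    | zero => exact fun _ => Finset.card_pos.2 ⟨i, self_mem_reachLe M i 0⟩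
    | succ t ih =>
      intro ht
      have hlt := Finset.card_lt_card
        ((reachLe_subset_succ M i t).ssubset_of_ne (hne t (by omega)).symm)
      have := ih (by omega)
      omega
  have h1 := hcard n le_rfl
  have h2 := Finset.card_le_univ (reachLe M i n)
  rw [Fintype.card_fin] at h2
  omega

/-- If all matrices of `l` have at most one `1` in each row indexed by `S` and map `S` to itself,
so has their product. -/
lemma listProd_apply_unique {n : ℕ} {S : Set (Fin n)} {l : List (BMat n)}
    (hclosed : ∀ A ∈ l, ∀ i ∈ S, ∀ j, A i j = true → j ∈ S)
    (huniq : ∀ A ∈ l, ∀ i ∈ S, ∀ j k, A i j = true → A i k = true → j = k)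
    {i j k : Fin n} (hi : i ∈ S) (hj : listProd l i j = true) (hk : listProd l i k = true) :
    j = k := by
  induction l generalizing i with
  | nil => exact ((listProd_nil_apply i j).1 hj).symm.trans ((listProd_nil_apply i k).1 hk)
  | cons A l ih =>
    obtain ⟨a, ha, haj⟩ := (listProd_cons_apply A l i j).1 hj
    obtain ⟨b, hb, hbk⟩ := (listProd_cons_apply A l i k).1 hk
    obtain rfl := huniq A (by simp) i hi a b ha hb
    exact ih (fun B hB => hclosed B (by simp [hB])) (fun B hB => huniq B (by simp [hB]))
      (hclosed A (by simp) i hi a ha) haj hbk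

/-- In a primitive set, every row acquires two `1`s in a product of at most `n` matrices. -/
lemma IsPrimitive.exists_two_ones {n : ℕ} (hn : 2 ≤ n) {M : Set (BMat n)} (hprim : IsPrimitive M)
    (i : Fin n) : ∃ A ∈ prodsLe M n, ∃ j k, j ≠ k ∧ A i j = true ∧ A i k = true := by
  by_contra! hone
  obtain ⟨t, ht, heq⟩ := exists_reachLe_succ_eq M i
  obtain ⟨l, -, hlM, hl⟩ := hprim
  have huniq : ∀ A ∈ M, ∀ m ∈ reachLe M i t, ∀ j k,
      A m j = true → A m k = true → j = k := by
    intro A hA m hm j k hj hk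
    obtain ⟨l', h1, h2, h⟩ := mem_reachLe.1 hm
    by_contra hjk
    refine hone (listProd (l' ++ [A])) ⟨l' ++ [A], ?_, ?_, rfl⟩ j k hjk
      ((listProd_concat_apply l' A i j).2 ⟨m, h, hj⟩)
      ((listProd_concat_apply l' A i k).2 ⟨m, h, hk⟩)
    · simp only [List.length_append, List.length_singleton]
      omega
    · simp only [List.mem_append, List.mem_singleton]
      rintro B (hB | rfl)
      exacts [h2 B hB, hA]
  have h01 : (⟨0, by omega⟩ : Fin n) = ⟨1, by omega⟩ :=
    listProd_apply_unique (S := reachLe M i t) (l := l) (i := i)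
      (fun A hA m hm j hj => heq ▸ mem_reachLe_succ hm (hlM A hA) hj)
      (fun A hA m hm => huniq A (hlM A hA) m hm) (self_mem_reachLe M i t)
      (by rw [hl]; rfl) (by rw [hl]; rfl)
  simp at h01

lemma rowSum_eq_rCount {n : ℕ} (A : BMat n) (i : Fin n) : rowSum A i = rCount A i := by
  simp [rowSum, rCount]

lemma one_le_rowSum {n : ℕ} {A : BMat n} {i j : Fin n} (h : A i j = true) : 1 ≤ rowSum A i := by
  rw [rowSum_eq_rCount, Nat.one_le_cast]
  exact Finset.card_pos.2 ⟨j, by simpa using h⟩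

lemma two_le_rowSum {n : ℕ} {A : BMat n} {i j k : Fin n} (hjk : j ≠ k) (hj : A i j = true)
    (hk : A i k = true) : 2 ≤ rowSum A i := by
  rw [rowSum_eq_rCount, Nat.ofNat_le_cast]
  exact Finset.one_lt_card.2 ⟨j, by simpa using hj, k, by simpa using hk, hjk⟩

lemma IsStochastic.exists_inv_le {n : ℕ} (hn : 0 < n) {p : Fin n → ℝ} (hp : IsStochastic p) :
    ∃ i, (1 : ℝ) / n ≤ p i := by
  have hn' : (n : ℝ) ≠ 0 := by positivity
  by_contra! hlt
  have : ∑ i, p i < ∑ _i : Fin n, (1 : ℝ) / n :=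
    Finset.sum_lt_sum_of_nonempty ⟨⟨0, hn⟩, Finset.mem_univ _⟩ fun i _ => hlt i
  simp [hp.2, hn'] at this

lemma one_add_le_payoff {n : ℕ} {p : Fin n → ℝ} (hp : IsStochastic p) {A : BMat n}
    (hA : ∀ i, 1 ≤ rowSum A i) {i : Fin n} (hi : 2 ≤ rowSum A i) : 1 + p i ≤ payoff p A := by
  have hle : ∑ j, p j * (rowSum A j - 1) ≥ p i * (rowSum A i - 1) :=
    Finset.single_le_sum (f := fun j => p j * (rowSum A j - 1))
      (fun j _ => mul_nonneg (hp.1 j) (sub_nonneg.2 (hA j))) (Finset.mem_univ i)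
  have hsum : ∑ j, p j * (rowSum A j - 1) = payoff p A - 1 := by
    simp only [mul_sub, mul_one, Finset.sum_sub_distrib, hp.2, payoff]
  nlinarith [hp.1 i]

lemma payoff_le_maxPayoff {n : ℕ} {M : Set (BMat n)} {t : ℕ} {A : BMat n} (hA : A ∈ prodsLe M t)
    (p : Fin n → ℝ) : payoff p A ≤ maxPayoff M t p := by
  refine le_csSup ?_ ⟨A, hA, rfl⟩
  refine ((Set.toFinite (prodsLe M t)).image (payoff p)).bddAbove.mono ?_
  rintro _ ⟨B, hB, rfl⟩
  exact ⟨B, hB, rfl⟩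

lemma exists_isStochastic {n : ℕ} (hn : 0 < n) : ∃ p : Fin n → ℝ, IsStochastic p :=
  ⟨Pi.single ⟨0, hn⟩ 1, fun i => by
    by_cases h : i = ⟨0, hn⟩ <;> simp [h], by simp⟩

/-- for `n ≥ 2` and `𝓜` a primitive finite set of `n×n` binary NZ
matrices, `K_𝓜(n) > 1/n`. -/
theorem stmt_5 {n : ℕ} (hn : 2 ≤ n) (M : Set (BMat n)) (hfin : M.Finite)
    (hNZ : ∀ A ∈ M, IsNZ A) (hprim : IsPrimitive M) :
    Kval M n > 1 / n := by
  have hn0 : (0 : ℝ) < n := by positivity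
  have hbound : (1 : ℝ) + 1 / n ≤
      sInf { v | ∃ p : Fin n → ℝ, IsStochastic p ∧ v = maxPayoff M n p } := by
    obtain ⟨q, hq⟩ := exists_isStochastic (n := n) (by omega)
    refine le_csInf ⟨_, q, hq, rfl⟩ ?_
    rintro _ ⟨p, hp, rfl⟩
    obtain ⟨i, hi⟩ := hp.exists_inv_le (by omega)
    obtain ⟨_, hA, j, k, hjk, hj, hk⟩ := hprim.exists_two_ones hn i
    obtain ⟨l, -, hlM, rfl⟩ := id hA
    have hrow : ∀ m, 1 ≤ rowSum (listProd l) m := fun m =>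
      have ⟨_, hm⟩ := exists_listProd_apply (fun A hA => (hNZ A (hlM A hA)).1) m
      one_le_rowSum hm
    have h1 := one_add_le_payoff hp hrow (two_le_rowSum hjk hj hk)
    have h2 := payoff_le_maxPayoff hA p
    linarith
  have hpos : (0 : ℝ) < 1 / n := by positivity
  exact div_lt_div_of_pos_right (by linarith) hn0
end

section
/- Let 𝓜 be a primitive finite set of n×n binary NZ matrices and t ≥ 0 such that K̄_𝓜(t) < 1, K̄_𝓜(t) = K̄_𝓜(t+1), and |P̄_t| < n. Then K̄_𝓜(t+n−1) > K̄_𝓜(t). -/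
open scoped BigOperators

lemma bddAbove_rCount_prodsLe {n : ℕ} (M : Set (BMat n)) (t : ℕ) (i : Fin n) :
    BddAbove { r | ∃ A ∈ prodsLe M t, r = rCount A i } := by
  refine ⟨n, ?_⟩
  rintro r ⟨A, -, rfl⟩
  exact (Finset.card_le_univ _).trans_eq (Fintype.card_fin n)

lemma rCount_le_rowMaxN {n : ℕ} {M : Set (BMat n)} {t : ℕ} {A : BMat n}
    (hA : A ∈ prodsLe M t) (i : Fin n) : rCount A i ≤ rowMaxN M t i :=
  le_csSup (bddAbove_rCount_prodsLe M t i) ⟨A, hA, rfl⟩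

lemma exists_rCount_eq_rowMaxN {n : ℕ} (M : Set (BMat n)) (t : ℕ) (i : Fin n) :
    ∃ A ∈ prodsLe M t, rowMaxN M t i = rCount A i :=
  Nat.sSup_mem (s := { r | ∃ A ∈ prodsLe M t, r = rCount A i })
    ⟨_, bId n, ⟨[], by simp, by simp, rfl⟩, rfl⟩
    (bddAbove_rCount_prodsLe M t i)

lemma rowMaxN_mono {n : ℕ} (M : Set (BMat n)) (i : Fin n) :
    Monotone fun t => rowMaxN M t i := by
  intro s t hst
  obtain ⟨A, ⟨l, hl, hM, rfl⟩, h⟩ := exists_rCount_eq_rowMaxN M s i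
  exact h.trans_le (rCount_le_rowMaxN ⟨l, hl.trans hst, hM, rfl⟩ i)

/-- A row inherits the maximal weight of any row it reaches in one step. -/
lemma rowMaxN_le_succ_of_edge {n : ℕ} {M : Set (BMat n)} {B : BMat n} (hB : B ∈ M)
    {i k : Fin n} (hik : B i k = true) (t : ℕ) : rowMaxN M t k ≤ rowMaxN M (t + 1) i := by
  obtain ⟨A, ⟨l, hl, hM, rfl⟩, h⟩ := exists_rCount_eq_rowMaxN M t k
  have hmem : listProd (B :: l) ∈ prodsLe M (t + 1) :=
    ⟨B :: l, by simpa using hl, by simpa using ⟨hB, hM⟩, rfl⟩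
  refine (h.trans_le ?_).trans (rCount_le_rowMaxN hmem i)
  refine Finset.card_le_card fun j hj => ?_
  simp only [Finset.mem_filter, Finset.mem_univ, true_and] at hj ⊢
  exact decide_eq_true ⟨k, hik, hj⟩

lemma mem_of_listProd_of_closed {n : ℕ} {M : Set (BMat n)} {Q : Set (Fin n)}
    (hQ : ∀ A ∈ M, ∀ i ∈ Q, ∀ k, A i k = true → k ∈ Q) (l : List (BMat n))
    (hl : ∀ A ∈ l, A ∈ M) {i j : Fin n} (hi : i ∈ Q) (hij : listProd l i j = true) : j ∈ Q := by
  induction l generalizing i with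
  | nil =>
    have : i = j := of_decide_eq_true hij
    exact this ▸ hi
  | cons A l ih =>
    obtain ⟨k, hik, hkj⟩ : ∃ k, A i k = true ∧ listProd l k j = true := of_decide_eq_true hij
    exact ih (fun B hB => hl B (by simp [hB])) (hQ A (hl A (by simp)) i hi k hik) hkj

/-- The transition graph of a primitive set is strongly connected: a nonempty proper set of
indices has an outgoing edge. -/
lemma IsPrimitive.exists_edge_out {n : ℕ} {M : Set (BMat n)} (hM : IsPrimitive M)
    {Q : Set (Fin n)} (hne : Q.Nonempty) (huniv : Q ≠ Set.univ) :
    ∃ A ∈ M, ∃ i ∈ Q, ∃ k, A i k = true ∧ k ∉ Q := by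
  by_contra! h
  obtain ⟨l, -, hl, hones⟩ := hM
  obtain ⟨i, hi⟩ := hne
  exact huniv (Set.eq_univ_of_forall fun j =>
    mem_of_listProd_of_closed h l hl hi (by simp [hones, bOnes]))

/-- While some but not all rows have maximal weight at most `m`, each further step strictly
decreases the number of such rows. -/
lemma ncard_rowMaxN_le_add_lt {n : ℕ} {M : Set (BMat n)} (hM : IsPrimitive M) {t m : ℕ}
    (h : { i | rowMaxN M t i ≤ m }.ncard < n) (s : ℕ) :
    { i | rowMaxN M (t + s) i ≤ m }.ncard + s < n ∨ { i | rowMaxN M (t + s) i ≤ m } = ∅ := by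
  induction s with
  | zero => exact Or.inl h
  | succ s ih =>
    have hsub : { i | rowMaxN M (t + (s + 1)) i ≤ m } ⊆ { i | rowMaxN M (t + s) i ≤ m } :=
      fun i hi => (rowMaxN_mono M i (by omega : t + s ≤ t + (s + 1))).trans hi
    rcases Set.eq_empty_or_nonempty { i | rowMaxN M (t + s) i ≤ m } with he | hne
    · exact Or.inr (Set.subset_empty_iff.1 (he ▸ hsub))
    · have hcard := ih.resolve_right hne.ne_empty
      have huniv : { i | rowMaxN M (t + s) i ≤ m } ≠ Set.univ := by
        intro hu
        rw [hu, Set.ncard_univ, Nat.card_fin] at hcard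
        omega
      obtain ⟨A, hA, i, hi, k, hik, hk⟩ := hM.exists_edge_out hne huniv
      have hlt : { i | rowMaxN M (t + (s + 1)) i ≤ m }.ncard
          < { i | rowMaxN M (t + s) i ≤ m }.ncard :=
        Set.ncard_lt_ncard ⟨hsub, fun hs =>
          hk ((rowMaxN_le_succ_of_edge hA hik (t + s)).trans (hs hi))⟩
      left
      omega

lemma KbarN_le {n : ℕ} (M : Set (BMat n)) (t : ℕ) (i : Fin n) : KbarN M t ≤ rowMaxN M t i :=
  Nat.sInf_le ⟨i, rfl⟩

lemma exists_KbarN_eq {n : ℕ} (hn : 1 ≤ n) (M : Set (BMat n)) (t : ℕ) :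
    ∃ i, KbarN M t = rowMaxN M t i :=
  Nat.sInf_mem (s := { r | ∃ i : Fin n, r = rowMaxN M t i }) ⟨_, ⟨0, hn⟩, rfl⟩

/-- if `K̄_𝓜(t) < 1`, `K̄_𝓜(t) = K̄_𝓜(t+1)` and `|P̄_t| < n`,
then `K̄_𝓜(t+n−1) > K̄_𝓜(t)`. -/
theorem stmt_13 {n : ℕ} (hn : 1 ≤ n) (M : Set (BMat n)) (hfin : M.Finite)
    (hNZ : ∀ A ∈ M, IsNZ A) (hprim : IsPrimitive M) (t : ℕ)
    (hlt : Kbar M t < 1) (heq : Kbar M t = Kbar M (t + 1))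
    (hP : (Pbar M t).ncard < n) :
    Kbar M (t + (n - 1)) > Kbar M t := by
  have hset : Pbar M t = { i | rowMaxN M t i ≤ KbarN M t } :=
    Set.ext fun i => (KbarN_le M t i).ge_iff_eq'.symm
  rw [hset] at hP
  have hempty : { i | rowMaxN M (t + (n - 1)) i ≤ KbarN M t } = ∅ := by
    rcases ncard_rowMaxN_le_add_lt hprim hP (n - 1) with h | h
    · exact (Set.ncard_eq_zero (Set.toFinite _)).1 (by omega)
    · exact h
  obtain ⟨i, hi⟩ := exists_KbarN_eq hn M (t + (n - 1))
  have hK : KbarN M t < KbarN M (t + (n - 1)) := by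
    rw [hi]
    exact not_le.1 fun hle => Set.eq_empty_iff_forall_notMem.1 hempty i hle
  have hn' : (0 : ℝ) < n := by exact_mod_cast hn
  exact div_lt_div_of_pos_right (by exact_mod_cast hK) hn'
end

section
/- Let 𝓜 be a primitive finite set of n×n binary NZ matrices. For a binary row-stochastic matrix R, let σ_R : {1,…,n} → {1,…,n} be the map sending i to the unique j with R[i,j] = 1. Let S be a nonempty subset of {1,…,n} such that for every M ∈ 𝓜, every binary row-stochastic matrix R with R ≤ M entrywise, and every i ∈ S, one has σ_R(i) ∈ S. Then S = {1,…,n}. -/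
open scoped BigOperators

/-- A `1`-entry of a matrix with no zero row extends to a dominated row-stochastic matrix. -/
theorem exists_stochastic_le {n : ℕ} {A : BMat n} (hA : ∀ i, ∃ j, A i j = true)
    {i j : Fin n} (hij : A i j = true) :
    ∃ R : BMat n, (∀ a, ∃! b, R a b = true) ∧ (∀ a b, R a b = true → A a b = true) ∧
      R i j = true := by
  choose f hf using hA
  refine ⟨Matrix.of fun a b => decide (Function.update f i j a = b), ?_, ?_, ?_⟩
  · intro a
    simp
  · intro a b h
    simp only [Matrix.of_apply, decide_eq_true_eq] at h
    subst h
    by_cases ha : a = i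
    · subst ha
      simpa using hij
    · simpa [Function.update_of_ne ha] using hf a
  · simp

/-- A set closed under the `1`-entries of each factor is closed under those of the product. -/
theorem mem_of_listProd {n : ℕ} {S : Set (Fin n)} {l : List (BMat n)}
    (hS : ∀ A ∈ l, ∀ i ∈ S, ∀ j, A i j = true → j ∈ S) :
    ∀ i ∈ S, ∀ j, listProd l i j = true → j ∈ S := by
  induction l with
  | nil =>
    intro i hi j h
    simp only [listProd, List.foldr_nil, bId, Matrix.of_apply, decide_eq_true_eq] at h
    exact h ▸ hi
  | cons A l ih =>
    intro i hi j h
    simp only [listProd, List.foldr_cons, bProd, Matrix.of_apply, decide_eq_true_eq] at h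
    obtain ⟨k, hik, hkj⟩ := h
    exact ih (fun B hB => hS B (List.mem_cons_of_mem A hB)) k
      (hS A List.mem_cons_self i hi k hik) j hkj

/-- if `𝓜` is primitive and `S` is a nonempty subset of indices
closed under `σ_R` for every binary row-stochastic `R` dominated by a matrix of
`𝓜`, then `S` is the whole index set. -/
theorem stmt_16 {n : ℕ} (hn : 1 ≤ n) (M : Set (BMat n)) (hfin : M.Finite)
    (hNZ : ∀ A ∈ M, IsNZ A) (hprim : IsPrimitive M) (S : Set (Fin n))
    (hSne : S.Nonempty)
    (hclosed : ∀ M0 ∈ M, ∀ R : BMat n,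
      (∀ i, ∃! j, R i j = true) →
      (∀ i j, R i j = true → M0 i j = true) →
      ∀ i ∈ S, ∀ j, R i j = true → j ∈ S) :
    S = Set.univ := by
  obtain ⟨l, -, hl, hprod⟩ := hprim
  obtain ⟨i, hi⟩ := hSne
  refine Set.eq_univ_of_forall fun j => mem_of_listProd (l := l) ?_ i hi j ?_
  · intro A hA a ha b hab
    obtain ⟨R, hR, hRA, hRab⟩ := exists_stochastic_le (hNZ A (hl A hA)).1 hab
    exact hclosed A (hl A hA) R hR hRA a ha b hRab
  · rw [hprod]
    rfl
end

section
/- Let n ≥ 2, let 𝓜 be a primitive finite set of n×n binary NZ matrices, and let a, b be positive integers such that: (i) for every t ≥ 0 with K_𝓜(t) < 1 one has K_𝓜(t+a) > K_𝓜(t), and (ii) for all t₁, t₂ ≥ 0, if K_𝓜(t₁) > K_𝓜(t₂) then K_𝓜(t₁) − K_𝓜(t₂) ≥ 1/b. Then exp(𝓜) ≤ a·⌈b(n−1)/n⌉. -/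
open scoped BigOperators

theorem rowSum_le {n : ℕ} (A : BMat n) (i : Fin n) : rowSum A i ≤ n := by
  calc rowSum A i ≤ ∑ _j : Fin n, (1 : ℝ) :=
        Finset.sum_le_sum fun j _ => by split_ifs <;> norm_num
    _ = n := by simp

theorem rowSum_bId {n : ℕ} (i : Fin n) : rowSum (bId n) i = 1 := by
  simp [rowSum, bId]

theorem payoff_le {n : ℕ} {p : Fin n → ℝ} (hp : IsStochastic p) (A : BMat n) :
    payoff p A ≤ n := by
  calc payoff p A ≤ ∑ i, p i * n :=
        Finset.sum_le_sum fun i _ => mul_le_mul_of_nonneg_left (rowSum_le A i) (hp.1 i)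
    _ = n := by rw [← Finset.sum_mul, hp.2, one_mul]

theorem payoff_bId {n : ℕ} {p : Fin n → ℝ} (hp : IsStochastic p) :
    payoff p (bId n) = 1 := by
  simp [payoff, rowSum_bId, hp.2]

theorem bId_mem_prodsLe {n : ℕ} (M : Set (BMat n)) (t : ℕ) : bId n ∈ prodsLe M t :=
  ⟨[], by simp, by simp, rfl⟩

theorem one_le_maxPayoff {n : ℕ} (M : Set (BMat n)) (t : ℕ) {p : Fin n → ℝ}
    (hp : IsStochastic p) : 1 ≤ maxPayoff M t p := by
  refine le_csSup ⟨n, ?_⟩ ⟨bId n, bId_mem_prodsLe M t, (payoff_bId hp).symm⟩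
  rintro x ⟨A, -, rfl⟩
  exact payoff_le hp A

theorem exists_payoff_eq_maxPayoff {n : ℕ} (M : Set (BMat n)) (t : ℕ) (p : Fin n → ℝ) :
    ∃ A ∈ prodsLe M t, maxPayoff M t p = payoff p A := by
  have hfin : { x | ∃ A ∈ prodsLe M t, x = payoff p A }.Finite :=
    ((Set.toFinite (prodsLe M t)).image (payoff p)).subset fun x hx => by
      obtain ⟨A, hA, rfl⟩ := hx
      exact ⟨A, hA, rfl⟩
  have hne : { x | ∃ A ∈ prodsLe M t, x = payoff p A }.Nonempty :=
    ⟨_, bId n, bId_mem_prodsLe M t, rfl⟩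
  exact hne.csSup_mem hfin

theorem isStochastic_uniform {n : ℕ} (hn : 0 < n) :
    IsStochastic fun _ : Fin n => (1 / n : ℝ) := by
  refine ⟨fun _ => by positivity, ?_⟩
  have : (n : ℝ) ≠ 0 := by positivity
  simp [this]

theorem inv_le_Kval {n : ℕ} (hn : 0 < n) (M : Set (BMat n)) (t : ℕ) :
    1 / (n : ℝ) ≤ Kval M t := by
  refine div_le_div_of_nonneg_right ?_ (Nat.cast_nonneg n)
  refine le_csInf ⟨_, _, isStochastic_uniform hn, rfl⟩ ?_
  rintro v ⟨p, hp, rfl⟩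
  exact one_le_maxPayoff M t hp

theorem Kval_le {n : ℕ} (M : Set (BMat n)) (t : ℕ) {p : Fin n → ℝ} (hp : IsStochastic p) :
    Kval M t ≤ maxPayoff M t p / n := by
  refine div_le_div_of_nonneg_right (csInf_le ⟨1, ?_⟩ ⟨p, hp, rfl⟩) (Nat.cast_nonneg n)
  rintro v ⟨q, hq, rfl⟩
  exact one_le_maxPayoff M t hq

theorem eq_bOnes_of_le_payoff_uniform {n : ℕ} (hn : 0 < n) {A : BMat n}
    (h : (n : ℝ) ≤ payoff (fun _ => 1 / n) A) : A = bOnes n := by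
  have hn' : (0 : ℝ) < 1 / n := by positivity
  have heq : payoff (fun _ => 1 / n) A = ∑ _i : Fin n, (1 / n : ℝ) * n := by
    rw [← Finset.sum_mul, (isStochastic_uniform hn).2, one_mul]
    exact le_antisymm (payoff_le (isStochastic_uniform hn) A) h
  have hrow := (Finset.sum_eq_sum_iff_of_le fun i _ =>
    mul_le_mul_of_nonneg_left (rowSum_le A i) hn'.le).1 heq
  ext i j
  have hi : rowSum A i = ∑ _j : Fin n, (1 : ℝ) := by
    simpa using mul_left_cancel₀ hn'.ne' (hrow i (Finset.mem_univ i))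
  have hj := (Finset.sum_eq_sum_iff_of_le fun j _ => by
    split_ifs <;> norm_num).1 hi j (Finset.mem_univ j)
  by_cases hA : A i j = true
  · simp [hA, bOnes]
  · simp [hA] at hj

theorem expM_le_of_one_le_Kval {n : ℕ} (hn : 2 ≤ n) {M : Set (BMat n)} {t : ℕ}
    (h : 1 ≤ Kval M t) : expM M ≤ t := by
  have hn0 : 0 < n := by omega
  obtain ⟨A, ⟨l, hlen, hl, hA⟩, hmax⟩ :=
    exists_payoff_eq_maxPayoff M t fun _ => (1 / n : ℝ)
  have hle := h.trans (Kval_le M t (isStochastic_uniform hn0))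
  rw [hmax, le_div_iff₀ (by positivity), one_mul] at hle
  have hones := eq_bOnes_of_le_payoff_uniform hn0 hle
  have hne : l ≠ [] := by
    rintro rfl
    have h01 := congrFun (congrFun (hA.symm.trans hones) ⟨0, by omega⟩) ⟨1, by omega⟩
    simp [listProd, bId, bOnes] at h01
  refine le_trans (Nat.sInf_le ?_) hlen
  exact ⟨l, rfl, hne, hl, hA.symm.trans hones⟩

theorem exists_one_le_or_add_div_le {K : ℕ → ℝ} {a : ℕ} {c : ℝ}
    (hK : ∀ t, K t < 1 → K t + c ≤ K (t + a)) (k : ℕ) :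
    (∃ t ≤ a * k, 1 ≤ K t) ∨ K 0 + k * c ≤ K (a * k) := by
  induction k with
  | zero => right; simp
  | succ k ih =>
    rcases ih with ⟨t, ht, h⟩ | h
    · exact Or.inl ⟨t, ht.trans (Nat.mul_le_mul_left a k.le_succ), h⟩
    · rcases le_or_gt 1 (K (a * k)) with h' | h'
      · exact Or.inl ⟨_, Nat.mul_le_mul_left a k.le_succ, h'⟩
      · right
        have := hK _ h'
        rw [Nat.mul_succ]
        push_cast
        linarith

/-- if every stagnation of `K_𝓜` has length less than `a` (in the
sense (i)) and every jump of `K_𝓜` is at least `1/b` (sense (ii)), then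
`exp(𝓜) ≤ a·⌈b(n−1)/n⌉`. -/
theorem stmt_19 {n : ℕ} (hn : 2 ≤ n) (M : Set (BMat n)) (hfin : M.Finite)
    (hNZ : ∀ A ∈ M, IsNZ A) (hprim : IsPrimitive M) (a b : ℕ)
    (ha : 1 ≤ a) (hb : 1 ≤ b)
    (h1 : ∀ t : ℕ, Kval M t < 1 → Kval M t < Kval M (t + a))
    (h2 : ∀ t1 t2 : ℕ, Kval M t2 < Kval M t1 →
      1 / (b : ℝ) ≤ Kval M t1 - Kval M t2) :
    expM M ≤ a * ⌈((b : ℚ) * ((n : ℚ) - 1)) / (n : ℚ)⌉₊ := by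
  have hn0 : 0 < n := by omega
  have hnR : (0 : ℝ) < n := by exact_mod_cast hn0
  have hbR : (0 : ℝ) < b := by exact_mod_cast hb
  set k := ⌈((b : ℚ) * ((n : ℚ) - 1)) / (n : ℚ)⌉₊ with hk
  have hstep : ∀ t, Kval M t < 1 → Kval M t + 1 / (b : ℝ) ≤ Kval M (t + a) := fun t ht => by
    linarith [h2 _ _ (h1 t ht)]
  rcases exists_one_le_or_add_div_le hstep k with ⟨t, ht, h⟩ | h
  · exact (expM_le_of_one_le_Kval hn h).trans ht
  · refine expM_le_of_one_le_Kval hn (le_trans ?_ h)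
    have hkQ : ((b : ℚ) * ((n : ℚ) - 1)) / n ≤ k := Nat.le_ceil _
    have hkR : ((b : ℝ) * ((n : ℝ) - 1)) / n ≤ k := by exact_mod_cast hkQ
    have hjumps : 1 - 1 / (n : ℝ) ≤ k * (1 / (b : ℝ)) := by
      rw [mul_one_div, le_div_iff₀ hbR]
      calc (1 - 1 / (n : ℝ)) * b = (b * ((n : ℝ) - 1)) / n := by field_simp
        _ ≤ k := hkR
    linarith [inv_le_Kval hn0 M 0]
end
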